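/- Let S be a finite non-orthogonal set of pure states that is maximally contextual, and let X be a scenario generated by S. Then every context C ∈ ℂ(X) with C ∩ S = ∅ is a PVM that strongly antidistinguishes S. -/

import Mathlib

open Matrix

/-- Square complex matrices of size `d`, acting on the Hilbert space `ℂ^d`. -/
abbrev Mat (d : ℕ) := Matrix (Fin d) (Fin d) ℂ

/-- An orthogonal projection. -/
def IsProjection {d : ℕ} (p : Mat d) : Prop := p.IsHermitian ∧ p * p = p

/-- A pure state: a rank-1 orthogonal projection `|ψ⟩⟨ψ|` for a unit vector `ψ`. -/
def IsPureState {d : ℕ} (ρ : Mat d) : Prop :=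
  ∃ ψ : Fin d → ℂ, star ψ ⬝ᵥ ψ = 1 ∧ ρ = vecMulVec ψ (star ψ)

/-- A PVM: a finite family of orthogonal projections, pairwise orthogonal, summing to `1`. -/
def IsPVM {d : ℕ} (P : Finset (Mat d)) : Prop :=
  (∀ p ∈ P, IsProjection p) ∧
  (∀ p ∈ P, ∀ q ∈ P, p ≠ q → p * q = 0) ∧
  ∑ p ∈ P, p = 1

/-- A PVM given as an indexed family. -/
def IsPVMFam {d : ℕ} {ι : Type} [Fintype ι] (π : ι → Mat d) : Prop :=
  (∀ i, IsProjection (π i)) ∧ (∀ i j, i ≠ j → π i * π j = 0) ∧ ∑ i, π i = 1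

/-- `P` weakly antidistinguishes `S`: every outcome of `P` excludes some state of `S`. -/
def WeaklyAntidistinguishes {d : ℕ} (P S : Finset (Mat d)) : Prop :=
  ∀ p ∈ P, ∃ ρ ∈ S, (p * ρ).trace = 0

/-- `S` is weakly antidistinguishable. -/
def IsWA {d : ℕ} (S : Finset (Mat d)) : Prop :=
  ∃ P : Finset (Mat d), IsPVM P ∧ WeaklyAntidistinguishes P S

/-- `P` strongly antidistinguishes `S`: it weakly antidistinguishes `S` and for each state
there is an outcome excluding that state and no other. -/
def StronglyAntidistinguishes {d : ℕ} (P S : Finset (Mat d)) : Prop :=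
  WeaklyAntidistinguishes P S ∧
  ∀ ρ ∈ S, ∃ p ∈ P, (p * ρ).trace = 0 ∧ ∀ ρ' ∈ S, ρ' ≠ ρ → (p * ρ').trace ≠ 0

/-- `S` is strongly antidistinguishable. -/
def IsSA {d : ℕ} (S : Finset (Mat d)) : Prop :=
  ∃ P : Finset (Mat d), IsPVM P ∧ StronglyAntidistinguishes P S

/-- `S = {ρ_1, …, ρ_N}` is antidistinguishable: there is a PVM `{π_i}_{i=1}^N`, with one
outcome per state, such that `Tr(π_i ρ_i) = 0` for each `i`. -/
def IsA {d : ℕ} (S : Finset (Mat d)) : Prop :=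
  ∃ π : Mat d → Mat d,
    (∀ ρ ∈ S, IsProjection (π ρ)) ∧
    (∀ ρ ∈ S, ∀ ρ' ∈ S, ρ ≠ ρ' → π ρ * π ρ' = 0) ∧
    (∑ ρ ∈ S, π ρ = 1) ∧
    ∀ ρ ∈ S, (π ρ * ρ).trace = 0

/-- A context: a finite set of rank-1 orthogonal projections, pairwise orthogonal,
summing to the identity. -/
def IsContext {d : ℕ} (C : Finset (Mat d)) : Prop :=
  (∀ p ∈ C, IsPureState p) ∧
  (∀ p ∈ C, ∀ q ∈ C, p ≠ q → p * q = 0) ∧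
  ∑ p ∈ C, p = 1

/-- A `{0,1}`-valued assignment on `X` such that every context drawn from `X`
has exactly one vertex assigned the value `1`. -/
def NoncontextualAssignment {d : ℕ} (X : Finset (Mat d)) (ν : Mat d → ℕ) : Prop :=
  (∀ σ ∈ X, ν σ = 0 ∨ ν σ = 1) ∧
  ∀ C ⊆ X, IsContext C → ∑ σ ∈ C, ν σ = 1

/-- `σ` is an implied projector of `S`: a rank-1 projection orthogonal to some state of `S`. -/
def ImpliedProjector {d : ℕ} (S : Finset (Mat d)) (σ : Mat d) : Prop :=
  IsPureState σ ∧ ∃ ρ ∈ S, ρ * σ = 0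

/-- `X` is a contextuality scenario generated by `S`: a finite set of rank-1 projections
with `S ⊆ X` and `X \ S ⊆ I(S)`. -/
def GeneratedScenario {d : ℕ} (S X : Finset (Mat d)) : Prop :=
  (∀ σ ∈ X, IsPureState σ) ∧ S ⊆ X ∧ ∀ σ ∈ X, σ ∉ S → ImpliedProjector S σ

/-- `S` is a contextual instance of the scenario `X`: there is no noncontextual value
assignment on `X` assigning `1` to every state of `S`. -/
def ContextualInstance {d : ℕ} (S X : Finset (Mat d)) : Prop :=
  ¬ ∃ ν : Mat d → ℕ, NoncontextualAssignment X ν ∧ ∀ ρ ∈ S, ν ρ = 1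

/-- `S` is contextual: some scenario generated by `S` has `S` as a contextual instance. -/
def IsContextualSet {d : ℕ} (S : Finset (Mat d)) : Prop :=
  ∃ X : Finset (Mat d), GeneratedScenario S X ∧ ContextualInstance S X

/-- `S` is non-orthogonal: distinct states have nonzero overlap. -/
def NonOrthogonal {d : ℕ} (S : Finset (Mat d)) : Prop :=
  ∀ ρ ∈ S, ∀ ρ' ∈ S, ρ ≠ ρ' → (ρ * ρ').trace ≠ 0

/-- `S` is maximally contextual: `S` is contextual and no proper subset of `S` is. -/
def MaximallyContextual {d : ℕ} (S : Finset (Mat d)) : Prop :=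
  IsContextualSet S ∧ ∀ S' ⊂ S, ¬ IsContextualSet S'

lemma vecMulVec_star_mul_vecMulVec_star {d : ℕ} (ψ φ : Fin d → ℂ) :
    vecMulVec ψ (star ψ) * vecMulVec φ (star φ) = (star ψ ⬝ᵥ φ) • vecMulVec ψ (star φ) := by
  rw [vecMulVec_mul_vecMulVec, vecMulVec_smul]

lemma trace_vecMulVec_star_mul_eq_zero_iff {d : ℕ} (ψ φ : Fin d → ℂ) :
    (vecMulVec ψ (star ψ) * vecMulVec φ (star φ)).trace = 0 ↔ star ψ ⬝ᵥ φ = 0 := by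
  have h : ψ ⬝ᵥ star φ = star (star ψ ⬝ᵥ φ) := by
    rw [dotProduct_star, dotProduct_comm φ]
  rw [vecMulVec_star_mul_vecMulVec_star, trace_smul, trace_vecMulVec, h, smul_eq_mul]
  simp

lemma IsPureState.isProjection {d : ℕ} {p : Mat d} (hp : IsPureState p) : IsProjection p := by
  obtain ⟨ψ, hψ, rfl⟩ := hp
  refine ⟨?_, ?_⟩
  · simp [IsHermitian, conjTranspose_vecMulVec]
  · rw [vecMulVec_star_mul_vecMulVec_star, hψ, one_smul]

lemma IsPureState.ne_zero {d : ℕ} {p : Mat d} (hp : IsPureState p) : p ≠ 0 := by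
  obtain ⟨ψ, hψ, rfl⟩ := hp
  intro h
  have ht := congrArg trace h
  rw [trace_vecMulVec, dotProduct_comm, hψ, trace_zero] at ht
  exact one_ne_zero ht

lemma IsPureState.ne_of_mul_eq_zero {d : ℕ} {p q : Mat d} (hp : IsPureState p)
    (h : p * q = 0) : p ≠ q := by
  rintro rfl
  exact hp.ne_zero (hp.isProjection.2 ▸ h)

lemma IsPureState.mul_eq_zero_of_trace {d : ℕ} {p q : Mat d} (hp : IsPureState p)
    (hq : IsPureState q) (h : (p * q).trace = 0) : p * q = 0 := by
  obtain ⟨ψ, -, rfl⟩ := hp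
  obtain ⟨φ, -, rfl⟩ := hq
  rw [vecMulVec_star_mul_vecMulVec_star, (trace_vecMulVec_star_mul_eq_zero_iff ψ φ).1 h, zero_smul]

/-- The rank-one projections onto the vectors of an orthonormal basis form a context. -/
lemma exists_isContext_of_orthonormalBasis {d : ℕ} {ι : Type*} [Fintype ι]
    (b : OrthonormalBasis ι ℂ (EuclideanSpace ℂ (Fin d))) :
    ∃ D : Finset (Mat d), IsContext D ∧
      ∀ i, vecMulVec (b i).ofLp (star (b i).ofLp) ∈ D := by
  classical
  let P : ι → Mat d := fun i => vecMulVec (b i).ofLp (star (b i).ofLp)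
  have hin : ∀ i j, star (b i).ofLp ⬝ᵥ (b j).ofLp = if i = j then 1 else 0 := fun i j => by
    rw [← orthonormal_iff_ite.1 b.orthonormal i j, EuclideanSpace.inner_eq_star_dotProduct,
      dotProduct_comm]
  have hpure : ∀ i, IsPureState (P i) := fun i => ⟨_, by simp [hin], rfl⟩
  have horth : ∀ i j, i ≠ j → P i * P j = 0 := fun i j hij => by
    simp only [P]
    rw [vecMulVec_star_mul_vecMulVec_star, hin, if_neg hij, zero_smul]
  have hinj : Function.Injective P := fun i j h => by
    by_contra hij
    exact (hpure i).ne_of_mul_eq_zero (horth i j hij) h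
  refine ⟨Finset.univ.image P, ⟨?_, ?_, ?_⟩, fun i => Finset.mem_image_of_mem P (Finset.mem_univ i)⟩
  · simpa using hpure
  · simp only [Finset.mem_image, Finset.mem_univ, true_and]
    rintro _ ⟨i, rfl⟩ _ ⟨j, rfl⟩ hne
    exact horth i j (fun h => hne (h ▸ rfl))
  · rw [Finset.sum_image fun i _ j _ h => hinj h]
    ext l k
    have h := congrArg (fun v => v.ofLp l) (b.sum_repr' (EuclideanSpace.single k (1 : ℂ)))
    simpa [P, Matrix.sum_apply, vecMulVec_apply, EuclideanSpace.inner_single_right, one_apply,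
      Pi.single_apply, mul_comm] using h

/-- Two orthogonal pure states lie in a common context. -/
lemma exists_isContext_of_mul_eq_zero {d : ℕ} {p q : Mat d} (hp : IsPureState p)
    (hq : IsPureState q) (h : p * q = 0) : ∃ D : Finset (Mat d), IsContext D ∧ p ∈ D ∧ q ∈ D := by
  obtain ⟨ψ, hψ, rfl⟩ := hp
  obtain ⟨φ, hφ, rfl⟩ := hq
  have h0 : star ψ ⬝ᵥ φ = 0 :=
    (trace_vecMulVec_star_mul_eq_zero_iff ψ φ).1 (by rw [h, trace_zero])
  have hv : Orthonormal ℂ ((↑) : ({WithLp.toLp 2 ψ, WithLp.toLp 2 φ} :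
      Set (EuclideanSpace ℂ (Fin d))) → EuclideanSpace ℂ (Fin d)) := by
    classical
    have h0' : star φ ⬝ᵥ ψ = 0 := by
      rw [star_dotProduct, h0, star_zero]
    have hne : ψ ≠ φ := by
      rintro rfl
      exact one_ne_zero (hψ.symm.trans h0)
    rw [orthonormal_subtype_iff_ite]
    rintro v (rfl | rfl) w (rfl | rfl) <;>
      simp [-inner_self_eq_norm_sq_to_K, EuclideanSpace.inner_eq_star_dotProduct,
        dotProduct_comm _ (star _), hψ, hφ, h0, h0', hne, hne.symm]
  obtain ⟨u, b, hu, hb⟩ := hv.exists_orthonormalBasis_extension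
  obtain ⟨D, hD, hmem⟩ := exists_isContext_of_orthonormalBasis b
  refine ⟨D, hD, ?_, ?_⟩
  · simpa [hb] using hmem ⟨WithLp.toLp 2 ψ, hu (by simp)⟩
  · simpa [hb] using hmem ⟨WithLp.toLp 2 φ, hu (by simp)⟩

lemma IsContext.isPVM {d : ℕ} {C : Finset (Mat d)} (hC : IsContext C) : IsPVM C :=
  ⟨fun p hp => (hC.1 p hp).isProjection, hC.2⟩

/-- In a context containing a projector of value `1`, every other projector has value `0`. -/
lemma NoncontextualAssignment.eq_zero {d : ℕ} {X D : Finset (Mat d)} {ν : Mat d → ℕ}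
    (hν : NoncontextualAssignment X ν) (hDX : D ⊆ X) (hD : IsContext D) {p q : Mat d}
    (hp : p ∈ D) (hq : q ∈ D) (hne : p ≠ q) (h1 : ν p = 1) : ν q = 0 := by
  classical
  have hsum := hν.2 D hDX hD
  have hle : ∑ σ ∈ {p, q}, ν σ ≤ ∑ σ ∈ D, ν σ :=
    Finset.sum_le_sum_of_subset (by simp [Finset.insert_subset_iff, hp, hq])
  rw [Finset.sum_pair hne] at hle
  omega

/-- If every projector of some context is orthogonal to a state of `S`, then `S` is contextual. -/
lemma isContextualSet_of_isContext {d : ℕ} {S C : Finset (Mat d)}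
    (hpure : ∀ ρ ∈ S, IsPureState ρ) (hC : IsContext C)
    (hSC : ∀ p ∈ C, ∃ ρ ∈ S, ρ * p = 0) : IsContextualSet S := by
  classical
  choose! r hrS hr using hSC
  have hctx : ∀ p ∈ C, ∃ D : Finset (Mat d), IsContext D ∧ r p ∈ D ∧ p ∈ D := fun p hp =>
    exists_isContext_of_mul_eq_zero (hpure _ (hrS p hp)) (hC.1 p hp) (hr p hp)
  choose! D hD hrD hpD using hctx
  have hCD : ∀ p ∈ C, D p ⊆ S ∪ C.biUnion D := fun p hp =>
    (Finset.subset_biUnion_of_mem D hp).trans Finset.subset_union_right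
  have himpl : ∀ p ∈ C, ∀ σ ∈ D p, σ ∉ S → ImpliedProjector S σ := fun p hp σ hσ hσS =>
    ⟨(hD p hp).1 σ hσ, r p, hrS p hp,
      (hD p hp).2.1 _ (hrD p hp) _ hσ fun h => hσS (h ▸ hrS p hp)⟩
  refine ⟨S ∪ C.biUnion D, ⟨?_, Finset.subset_union_left, ?_⟩, ?_⟩
  · intro σ hσ
    rcases Finset.mem_union.1 hσ with h | h
    · exact hpure σ h
    · obtain ⟨p, hp, hσp⟩ := Finset.mem_biUnion.1 h
      exact (hD p hp).1 σ hσp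
  · intro σ hσ hσS
    obtain ⟨p, hp, hσp⟩ := Finset.mem_biUnion.1 ((Finset.mem_union.1 hσ).resolve_left hσS)
    exact himpl p hp σ hσp hσS
  · rintro ⟨ν, hν, h1⟩
    have hzero : ∀ p ∈ C, ν p = 0 := fun p hp =>
      hν.eq_zero (hCD p hp) (hD p hp) (hrD p hp) (hpD p hp)
        ((hpure _ (hrS p hp)).ne_of_mul_eq_zero (hr p hp)) (h1 _ (hrS p hp))
    have hsum := hν.2 C (fun p hp => hCD p hp (hpD p hp)) hC
    rw [Finset.sum_eq_zero hzero] at hsum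
    exact zero_ne_one hsum

/-- If `S` is a finite non-orthogonal maximally contextual set of pure
states and `X` is a scenario generated by `S`, then every context `C ∈ ℂ(X)` with
`C ∩ S = ∅` is a PVM that strongly antidistinguishes `S`. -/
theorem statement_9 {d : ℕ} (S X : Finset (Mat d))
    (hpure : ∀ ρ ∈ S, IsPureState ρ) (hnon : NonOrthogonal S)
    (hmax : MaximallyContextual S) (hgen : GeneratedScenario S X)
    (C : Finset (Mat d)) (hCX : C ⊆ X) (hC : IsContext C)
    (hdisj : ∀ p ∈ C, p ∉ S) :
    IsPVM C ∧ StronglyAntidistinguishes C S := by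
  classical
  have hweak : WeaklyAntidistinguishes C S := fun p hp => by
    obtain ⟨-, ρ, hρ, h⟩ := hgen.2.2 p (hCX hp) (hdisj p hp)
    exact ⟨ρ, hρ, by rw [trace_mul_comm, h, trace_zero]⟩
  refine ⟨hC.isPVM, hweak, fun ρ hρ => ?_⟩
  by_contra! hcon
  refine hmax.2 _ (Finset.erase_ssubset hρ)
    (isContextualSet_of_isContext (fun σ hσ => hpure σ (Finset.mem_of_mem_erase hσ)) hC ?_)
  have hex : ∀ p ∈ C, ∃ ρ' ∈ S, ρ' ≠ ρ ∧ (p * ρ').trace = 0 := fun p hp => by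
    by_cases h : (p * ρ).trace = 0
    · exact hcon p hp h
    · obtain ⟨ρ', hρ', h'⟩ := hweak p hp
      exact ⟨ρ', hρ', fun he => h (he ▸ h'), h'⟩
  intro p hp
  obtain ⟨ρ', hρ', hne, h⟩ := hex p hp
  exact ⟨ρ', Finset.mem_erase.2 ⟨hne, hρ'⟩,
    (hpure ρ' hρ').mul_eq_zero_of_trace (hC.1 p hp) (by rwa [trace_mul_comm])⟩
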